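/- For every n ≥ 1 and every real number z, ∑_{F ∈ R_n} z^{c(F)} ∏_{v ∈ V(F)} 1/h(v) = z(z+1)(z+2)⋯(z+n−1), where c(F) is the number of connected components of F. -/

import Mathlib

/-- A rooted forest on vertex set `V`, encoded by its parent function:
`parent v = some u` means `u` is the parent of `v` (edges are directed away from
the roots, so `(u,v)` is an edge), and `parent v = none` means `v` is a root.
Acyclicity guarantees that every connected component is a tree with a
distinguished root. -/
structure RootedForest (V : Type) where
  parent : V → Option V
  acyclic : ∀ v : V, ¬ Relation.TransGen (fun a b : V => parent a = some b) v v

namespace RootedForest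

variable {V : Type} [Fintype V] [LinearOrder V]

/-- `F.Desc u v` means `v` is a (strict) descendant of `u`. -/
def Desc (F : RootedForest V) (u v : V) : Prop :=
  Relation.TransGen (fun a b : V => F.parent a = some b) v u

/-- The hook of `u`: `u` together with all of its descendants. -/
def hook (F : RootedForest V) (u : V) : Set V := {v : V | v = u ∨ F.Desc u v}

/-- The hook length `h(u)`. -/
noncomputable def h (F : RootedForest V) (u : V) : ℕ := (F.hook u).ncard

/-- The left hook length `h_L(u)`: sum of hook lengths of children smaller than `u`. -/
noncomputable def hL (F : RootedForest V) (u : V) : ℕ :=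
  ∑ v ∈ Finset.univ.filter (fun v : V => F.parent v = some u ∧ v < u), F.h v

/-- The right hook length `h_R(u)`: sum of hook lengths of children larger than `u`. -/
noncomputable def hR (F : RootedForest V) (u : V) : ℕ :=
  ∑ v ∈ Finset.univ.filter (fun v : V => F.parent v = some u ∧ u < v), F.h v

/-- The major index of a rooted forest. -/
noncomputable def maj (F : RootedForest V) : ℕ := ∑ u : V, F.hL u

/-- The comajor index of a rooted forest. -/
noncomputable def comaj (F : RootedForest V) : ℕ := ∑ u : V, F.hR u

/-- The number of inversions: pairs `(u,v)` with `v` a descendant of `u` and `v < u`. -/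
noncomputable def inv (F : RootedForest V) : ℕ :=
  {p : V × V | F.Desc p.1 p.2 ∧ p.2 < p.1}.ncard

/-- The number of coinversions: pairs `(u,v)` with `v` a descendant of `u` and `v > u`. -/
noncomputable def coinv (F : RootedForest V) : ℕ :=
  {p : V × V | F.Desc p.1 p.2 ∧ p.1 < p.2}.ncard

/-- The number of connected components (= number of roots). -/
def comps (F : RootedForest V) : ℕ :=
  (Finset.univ.filter (fun v : V => F.parent v = none)).card

end RootedForest

/-- A `k`-forest on vertex set `Fin n` (vertices `1,…,n`): a rooted forest together with a
colour in `{0,…,k-1}` on each edge.  The colour of the edge `(parent v, v)` is recorded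
at the vertex `v`; roots carry the dummy colour `0`. -/
structure KForest (n k : ℕ) extends RootedForest (Fin n) where
  colour : Fin n → ℕ
  colour_lt : ∀ v, colour v < k
  colour_root : ∀ v, parent v = none → colour v = 0

namespace KForest

variable {n k : ℕ}

/-- The chromatic depth `chr_k(F) = ∑_{(u,v) ∈ E(F)} κ(u,v)·h(v)`. -/
noncomputable def chr (F : KForest n k) : ℕ :=
  ∑ v ∈ Finset.univ.filter (fun v : Fin n => F.parent v ≠ none),
    F.colour v * F.toRootedForest.h v

/-- The chromatic codepth `cochr_k(F) = ∑_{(u,v) ∈ E(F)} (k-1-κ(u,v))·h(v)`. -/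
noncomputable def cochr (F : KForest n k) : ℕ :=
  ∑ v ∈ Finset.univ.filter (fun v : Fin n => F.parent v ≠ none),
    (k - 1 - F.colour v) * F.toRootedForest.h v

/-- `maj_k = maj + chr_k`. -/
noncomputable def majk (F : KForest n k) : ℕ := F.toRootedForest.maj + F.chr

/-- `comaj_k = comaj + cochr_k`. -/
noncomputable def comajk (F : KForest n k) : ℕ := F.toRootedForest.comaj + F.cochr

/-- `inv_k = inv + chr_k`. -/
noncomputable def invk (F : KForest n k) : ℕ := F.toRootedForest.inv + F.chr

/-- `coinv_k = coinv + cochr_k`. -/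
noncomputable def coinvk (F : KForest n k) : ℕ := F.toRootedForest.coinv + F.cochr

end KForest

/-- A minimal factorization of the long cycle `(0 1 ⋯ n)` on `{0,1,…,n}` into `n`
transpositions `(aᵢ bᵢ)` with `aᵢ < bᵢ`, multiplied left to right (the leftmost factor
is applied first, which corresponds to the reversed product in Mathlib's convention). -/
structure MinFact (n : ℕ) where
  a : Fin n → Fin (n+1)
  b : Fin n → Fin (n+1)
  ab_lt : ∀ i, a i < b i
  prod_eq : (List.ofFn (fun i => Equiv.swap (a i) (b i))).reverse.prod = finRotate (n+1)

namespace MinFact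

variable {n : ℕ}

/-- `area(f) = C(n,2) - ∑ aᵢ`. -/
def area (f : MinFact n) : ℤ := (n.choose 2 : ℤ) - ∑ i : Fin n, ((f.a i : ℕ) : ℤ)

/-- `coarea(f) = ∑ (bᵢ - 1) - C(n,2)`. -/
def coarea (f : MinFact n) : ℤ :=
  (∑ i : Fin n, (((f.b i : ℕ) : ℤ) - 1)) - (n.choose 2 : ℤ)

end MinFact

/-- A minimal `k`-factorization of the long cycle `(0 1 ⋯ kn)` on `{0,1,…,kn}` into `n`
cycles of length `k+1`: the `j`-th factor is the cycle `(a j 0, a j 1, …, a j k)`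
(sending `a j 0 ↦ a j 1 ↦ ⋯ ↦ a j k ↦ a j 0`), presented with its least element first,
and the factors are multiplied left to right (leftmost applied first). -/
structure MinKFact (n k : ℕ) where
  a : Fin n → Fin (k+1) → Fin (k*n+1)
  inj : ∀ j, Function.Injective (a j)
  min_first : ∀ j i, a j 0 ≤ a j i
  prod_eq :
    (List.ofFn (fun j => (List.ofFn (a j)).formPerm)).reverse.prod = finRotate (k*n+1)

namespace MinKFact

variable {n k : ℕ}

/-- `area_k(f) = C(kn,2) - n·C(k,2) - k·∑_j a_j^0`. -/
def areak (f : MinKFact n k) : ℤ :=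
  ((k*n).choose 2 : ℤ) - n * (k.choose 2 : ℤ) - k * ∑ j : Fin n, ((f.a j 0 : ℕ) : ℤ)

/-- `coarea_k(f) = k·∑_j (a_j^k - 1) - C(kn,2) - n·C(k,2)`. -/
def coareak (f : MinKFact n k) : ℤ :=
  k * (∑ j : Fin n, (((f.a j (Fin.last k) : ℕ) : ℤ) - 1))
    - ((k*n).choose 2 : ℤ) - n * (k.choose 2 : ℤ)

/-- `semiarea_k(f) = C(kn,2) - ∑_{i=0}^{k-1} ∑_j a_j^i`. -/
def semiareak (f : MinKFact n k) : ℤ :=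
  ((k*n).choose 2 : ℤ) - ∑ i : Fin k, ∑ j : Fin n, ((f.a j i.castSucc : ℕ) : ℤ)

/-- `cosemiarea_k(f) = ∑_{i=1}^{k} ∑_j (a_j^i - 1) - C(kn,2)`. -/
def cosemiareak (f : MinKFact n k) : ℤ :=
  (∑ i : Fin k, ∑ j : Fin n, (((f.a j i.succ : ℕ) : ℤ) - 1)) - ((k*n).choose 2 : ℤ)

end MinKFact

/-- `p` is a `k`-parking function: its nondecreasing rearrangement `b = p ∘ sort p`
satisfies `b i ≤ k * i` (with 0-indexed `i`, matching `bᵢ ≤ k(i-1)` for 1-indexed `i`). -/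
def IsParkingFunction (k : ℕ) {n : ℕ} (p : Fin n → ℕ) : Prop :=
  ∀ i : Fin n, p (Tuple.sort p i) ≤ k * i

/-- The displacement `disp_k(p) = k·C(n,2) - ∑ᵢ aᵢ` of a `k`-parking function. -/
def dispk (k : ℕ) {n : ℕ} (p : Fin n → ℕ) : ℤ :=
  k * (n.choose 2 : ℤ) - ∑ i : Fin n, (p i : ℤ)

instance (V : Type) [Fintype V] : Finite (RootedForest V) :=
  Finite.of_injective (fun F => F.parent) (by
    rintro ⟨p, _⟩ ⟨q, _⟩ h
    simp only at h
    subst h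
    rfl)

noncomputable instance (n : ℕ) : Fintype (RootedForest (Fin n)) := Fintype.ofFinite _


namespace RootedForest

theorem ext_parent {V : Type} {F G : RootedForest V} (h : ∀ v, F.parent v = G.parent v) :
    F = G := by
  cases F; cases G
  congr
  exact funext h

/-- Deleting the root `r` from the parent function `p` gives `q`. -/
def DelRel {n : ℕ} (r : Fin (n+1)) (p : Fin (n+1) → Option (Fin (n+1)))
    (q : Fin n → Option (Fin n)) : Prop :=
  p r = none ∧ ∀ w u, p (r.succAbove w) = some (r.succAbove u) ↔ q w = some u

theorem DelRel.trans_imp {n : ℕ} {r : Fin (n+1)} {p : Fin (n+1) → Option (Fin (n+1))}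
    {q : Fin n → Option (Fin n)} (h : DelRel r p q) {a : Fin n} {y : Fin (n+1)}
    (hy : Relation.TransGen (fun a b => p a = some b) (r.succAbove a) y) :
    y = r ∨ ∃ b, y = r.succAbove b ∧ Relation.TransGen (fun a b => q a = some b) a b := by
  induction hy with
  | @single y hab =>
    rcases Fin.eq_self_or_eq_succAbove r y with rfl | ⟨b, rfl⟩
    · exact Or.inl rfl
    · exact Or.inr ⟨b, rfl, .single ((h.2 _ _).1 hab)⟩
  | @tail y z _ hyz ih =>
    rcases ih with rfl | ⟨b, rfl, hb⟩
    · rw [h.1] at hyz; cases hyz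
    · rcases Fin.eq_self_or_eq_succAbove r z with rfl | ⟨c, rfl⟩
      · exact Or.inl rfl
      · exact Or.inr ⟨c, rfl, hb.tail ((h.2 _ _).1 hyz)⟩

theorem DelRel.trans_iff {n : ℕ} {r : Fin (n+1)} {p : Fin (n+1) → Option (Fin (n+1))}
    {q : Fin n → Option (Fin n)} (h : DelRel r p q) (a b : Fin n) :
    Relation.TransGen (fun a b => p a = some b) (r.succAbove a) (r.succAbove b) ↔
      Relation.TransGen (fun a b => q a = some b) a b := by
  constructor
  · intro hy
    rcases h.trans_imp hy with h1 | ⟨c, hc, h2⟩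
    · exact absurd h1 (Fin.succAbove_ne r b)
    · rwa [Fin.succAbove_right_injective hc]
  · intro hy
    induction hy with
    | single hab => exact .single ((h.2 _ _).2 hab)
    | tail _ hbc ih => exact ih.tail ((h.2 _ _).2 hbc)

theorem DelRel.not_trans {n : ℕ} {r : Fin (n+1)} {p : Fin (n+1) → Option (Fin (n+1))}
    {q : Fin n → Option (Fin n)} (h : DelRel r p q) (y : Fin (n+1)) :
    ¬ Relation.TransGen (fun a b => p a = some b) r y := by
  intro hy
  rw [Relation.TransGen.head'_iff] at hy
  obtain ⟨c, hc, _⟩ := hy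
  rw [h.1] at hc; cases hc

theorem DelRel.h_eq {n : ℕ} {r : Fin (n+1)} {F : RootedForest (Fin (n+1))}
    {G : RootedForest (Fin n)} (h : DelRel r F.parent G.parent) (w : Fin n) :
    F.h (r.succAbove w) = G.h w := by
  unfold RootedForest.h
  rw [← Set.ncard_image_of_injective (G.hook w) (Fin.succAbove_right_injective (p := r))]
  congr 1
  ext v
  simp only [hook, Desc, Set.mem_setOf_eq, Set.mem_image]
  rcases Fin.eq_self_or_eq_succAbove r v with rfl | ⟨b, rfl⟩
  · constructor
    · rintro (h1 | h1)
      · exact absurd h1.symm (Fin.succAbove_ne _ _)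
      · exact absurd h1 (h.not_trans _)
    · rintro ⟨x, _, hx⟩
      exact absurd hx (Fin.succAbove_ne _ _)
  · rw [h.trans_iff]
    constructor
    · rintro (h1 | h1)
      · exact ⟨b, Or.inl (Fin.succAbove_right_injective h1), rfl⟩
      · exact ⟨b, Or.inr h1, rfl⟩
    · rintro ⟨x, hx, hxb⟩
      obtain rfl := Fin.succAbove_right_injective hxb
      rcases hx with rfl | hx
      · exact Or.inl rfl
      · exact Or.inr hx

/-- Insert a new root `r` whose children are the roots of `G` in `T`. -/
def insP {n : ℕ} (r : Fin (n+1)) (G : RootedForest (Fin n)) (T : Finset (Fin n)) :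
    Fin (n+1) → Option (Fin (n+1)) :=
  r.insertNth (α := fun _ => Option (Fin (n+1))) none (fun w =>
    match G.parent w with
    | some u => some (r.succAbove u)
    | none => if w ∈ T then some r else none)

theorem insP_self {n : ℕ} (r : Fin (n+1)) (G : RootedForest (Fin n)) (T : Finset (Fin n)) :
    insP r G T r = none := by simp [insP]

theorem insP_some {n : ℕ} (r : Fin (n+1)) (G : RootedForest (Fin n)) (T : Finset (Fin n))
    {w u : Fin n} (h : G.parent w = some u) :
    insP r G T (r.succAbove w) = some (r.succAbove u) := by simp [insP, h]

theorem insP_none {n : ℕ} (r : Fin (n+1)) (G : RootedForest (Fin n)) (T : Finset (Fin n))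
    {w : Fin n} (h : G.parent w = none) :
    insP r G T (r.succAbove w) = if w ∈ T then some r else none := by simp [insP, h]

theorem insP_rel {n : ℕ} (r : Fin (n+1)) (G : RootedForest (Fin n)) (T : Finset (Fin n)) :
    DelRel r (insP r G T) G.parent := by
  refine ⟨insP_self r G T, fun w u => ?_⟩
  rcases hw : G.parent w with _ | x
  · rw [insP_none r G T hw]
    split_ifs
    · simp [(Fin.succAbove_ne r u).symm]
    · simp
  · rw [insP_some r G T hw]
    simp [Fin.succAbove_right_inj]

def ins {n : ℕ} (r : Fin (n+1)) (G : RootedForest (Fin n)) (T : Finset (Fin n)) :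
    RootedForest (Fin (n+1)) where
  parent := insP r G T
  acyclic v hv := by
    rcases Fin.eq_self_or_eq_succAbove r v with rfl | ⟨b, rfl⟩
    · exact (insP_rel _ G T).not_trans _ hv
    · exact G.acyclic b (((insP_rel r G T).trans_iff b b).1 hv)

theorem exists_del {n : ℕ} (r : Fin (n+1)) (F : RootedForest (Fin (n+1)))
    (hF : F.parent r = none) : ∃ G : RootedForest (Fin n), DelRel r F.parent G.parent := by
  classical
  let q : Fin n → Option (Fin n) := fun w =>
    if h : ∃ u, F.parent (r.succAbove w) = some (r.succAbove u) then some h.choose else none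
  have hq : DelRel r F.parent q := by
    refine ⟨hF, fun w u => ?_⟩
    constructor
    · intro h
      have h' : ∃ u, F.parent (r.succAbove w) = some (r.succAbove u) := ⟨u, h⟩
      have := h'.choose_spec
      simp only [q, dif_pos h']
      exact congrArg some (Fin.succAbove_right_injective
        (Option.some.inj (h.symm.trans this))).symm
    · intro h
      by_cases h' : ∃ u, F.parent (r.succAbove w) = some (r.succAbove u)
      · have := h'.choose_spec
        simp only [q, dif_pos h'] at h
        rw [this, Option.some.inj h]
      · simp only [q, dif_neg h'] at h
        cases h
  exact ⟨⟨q, fun v hv => F.acyclic _ ((hq.trans_iff v v).2 hv)⟩, hq⟩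

/-- The set of roots. -/
def roots {n : ℕ} (G : RootedForest (Fin n)) : Finset (Fin n) :=
  Finset.univ.filter (fun v => G.parent v = none)

theorem mem_roots {n : ℕ} (G : RootedForest (Fin n)) (v : Fin n) :
    v ∈ G.roots ↔ G.parent v = none := by simp [roots]

theorem comps_eq {n : ℕ} (G : RootedForest (Fin n)) : G.comps = G.roots.card := by
  unfold comps roots
  congr

theorem roots_ins {n : ℕ} (r : Fin (n+1)) (G : RootedForest (Fin n)) (T : Finset (Fin n)) :
    (ins r G T).roots = insert r ((G.roots \ T).map r.succAboveEmb) := by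
  ext v
  rw [mem_roots]
  change insP r G T v = none ↔ _
  rcases Fin.eq_self_or_eq_succAbove r v with rfl | ⟨b, rfl⟩
  · simp [insP_self]
  · rcases hb : G.parent b with _ | x
    · rw [insP_none r G T hb]
      simp [mem_roots, hb, Fin.succAbove_right_inj, Fin.succAbove_ne]
    · rw [insP_some r G T hb]
      simp [mem_roots, hb, Fin.succAbove_right_inj, Fin.succAbove_ne]

theorem comps_ins {n : ℕ} (r : Fin (n+1)) (G : RootedForest (Fin n)) (T : Finset (Fin n))
    (hT : T ⊆ G.roots) : (ins r G T).comps = (G.roots.card - T.card) + 1 := by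
  rw [comps_eq, roots_ins, Finset.card_insert_of_notMem, Finset.card_map,
    Finset.card_sdiff_of_subset hT]
  simp [Fin.succAbove_ne]

theorem exists_ins {n : ℕ} (r : Fin (n+1)) (F : RootedForest (Fin (n+1)))
    (hF : F.parent r = none) : ∃ G : RootedForest (Fin n), ∃ T ⊆ G.roots, ins r G T = F := by
  classical
  obtain ⟨G, hG⟩ := exists_del r F hF
  refine ⟨G, Finset.univ.filter (fun w => F.parent (r.succAbove w) = some r), ?_, ?_⟩
  · intro w hw
    simp only [Finset.mem_filter, Finset.mem_univ, true_and] at hw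
    rw [mem_roots]
    rcases h : G.parent w with _ | x
    · rfl
    · rw [← hG.2, hw] at h
      exact absurd (Option.some.inj h).symm (Fin.succAbove_ne _ _)
  · apply ext_parent
    intro v
    change insP r G _ v = _
    rcases Fin.eq_self_or_eq_succAbove r v with rfl | ⟨b, rfl⟩
    · rw [insP_self, hF]
    · rcases hb : G.parent b with _ | x
      · rw [insP_none r G _ hb]
        rcases hp : F.parent (r.succAbove b) with _ | y
        · simp [hp]
        · rcases Fin.eq_self_or_eq_succAbove r y with rfl | ⟨c, rfl⟩
          · simp [hp]
          · rw [hG.2, hb] at hp; cases hp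
      · rw [insP_some r G _ hb, (hG.2 b x).2 hb]

theorem ins_inj {n : ℕ} (r : Fin (n+1)) {G G' : RootedForest (Fin n)} {T T' : Finset (Fin n)}
    (hT : T ⊆ G.roots) (hT' : T' ⊆ G'.roots) (h : ins r G T = ins r G' T') :
    G = G' ∧ T = T' := by
  have hp : insP r G T = insP r G' T' := congrArg RootedForest.parent h
  have hG : G = G' := by
    apply ext_parent
    intro v
    apply Option.ext
    intro u
    rw [← (insP_rel r G T).2, hp, (insP_rel r G' T').2]
  subst hG
  refine ⟨rfl, ?_⟩
  ext w
  by_cases hw : G.parent w = none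
  · have := congrFun hp (r.succAbove w)
    rw [insP_none r G T hw, insP_none r G T' hw] at this
    by_cases h1 : w ∈ T <;> by_cases h2 : w ∈ T' <;> simp_all
  · rw [← mem_roots] at hw
    exact ⟨fun h => absurd (hT h) hw, fun h => absurd (hT' h) hw⟩

theorem existsUnique_root {n : ℕ} (F : RootedForest (Fin n)) (v : Fin n) :
    ∃! r, F.parent r = none ∧ v ∈ F.hook r := by
  let R : Fin n → Fin n → Prop := fun u v => Relation.TransGen (fun a b => F.parent a = some b) v u
  have : IsTrans (Fin n) R := ⟨fun a b c h1 h2 => Relation.TransGen.trans h2 h1⟩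
  have : Std.Irrefl R := ⟨F.acyclic⟩
  have wf : WellFounded R := Finite.wellFounded_of_trans_of_irrefl R
  induction v using wf.induction with
  | _ v ih =>
    simp only [hook, Desc, Set.mem_setOf_eq] at ih ⊢
    rcases hv : F.parent v with _ | u
    · refine ⟨v, ⟨hv, Or.inl rfl⟩, ?_⟩
      rintro y ⟨_, rfl | hy⟩
      · rfl
      · rw [Relation.TransGen.head'_iff] at hy
        obtain ⟨c, hc, _⟩ := hy
        rw [hv] at hc; cases hc
    · obtain ⟨r, ⟨hr, hr2⟩, hu⟩ := ih u (.single hv)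
      refine ⟨r, ⟨hr, Or.inr ?_⟩, ?_⟩
      · rcases hr2 with rfl | h2
        · exact .single hv
        · exact .head hv h2
      · rintro y ⟨hy, hy2⟩
        apply hu y
        refine ⟨hy, ?_⟩
        rcases hy2 with rfl | hy2
        · rw [hv] at hy; cases hy
        · rw [Relation.TransGen.head'_iff] at hy2
          obtain ⟨c, hc, hc2⟩ := hy2
          rw [hv] at hc
          obtain rfl := Option.some.inj hc
          rcases Relation.reflTransGen_iff_eq_or_transGen.1 hc2 with h | h
          · exact Or.inl h.symm
          · exact Or.inr h

theorem sum_h_roots {n : ℕ} (F : RootedForest (Fin n)) : ∑ r ∈ F.roots, F.h r = n := by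
  classical
  have h1 : ∀ r, F.h r = ∑ v : Fin n, if v ∈ F.hook r then 1 else 0 := by
    intro r
    rw [RootedForest.h, Set.ncard_eq_toFinset_card', ← Finset.card_filter]
    congr 1
    ext; simp
  simp_rw [h1]
  rw [Finset.sum_comm]
  have h2 : ∀ v : Fin n, (∑ r ∈ F.roots, if v ∈ F.hook r then 1 else 0) = 1 := by
    intro v
    rw [← Finset.card_filter, Finset.card_eq_one]
    obtain ⟨r, hr, hu⟩ := F.existsUnique_root v
    refine ⟨r, ?_⟩
    ext y
    simp only [Finset.mem_filter, mem_roots, Finset.mem_singleton]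
    exact ⟨hu y, fun h => h ▸ hr⟩
  simp [h2]

theorem h_pos {n : ℕ} (F : RootedForest (Fin n)) (v : Fin n) : 0 < F.h v :=
  (Set.ncard_pos (Set.toFinite _)).2 ⟨v, Or.inl rfl⟩

/-- The weighted sum. -/
noncomputable def S (n : ℕ) (z : ℝ) : ℝ :=
  ∑ F : RootedForest (Fin n), z ^ F.comps * ∏ v : Fin n, (1 : ℝ) / (F.h v : ℝ)

theorem sum_root {n : ℕ} (r : Fin (n+1)) (z : ℝ) :
    ∑ F ∈ Finset.univ.filter (fun F : RootedForest (Fin (n+1)) => r ∈ F.roots),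
      z ^ F.comps * (∏ v, (1 : ℝ) / (F.h v : ℝ)) * (F.h r : ℝ) = z * S n (z + 1) := by
  have key : z * S n (z+1) = ∑ x ∈ (Finset.univ : Finset (RootedForest (Fin n))).sigma
      (fun G => G.roots.powerset),
      z ^ ((x.1.roots.card - x.2.card) + 1) * ∏ v, (1 : ℝ) / (x.1.h v : ℝ) := by
    rw [Finset.sum_sigma, S, Finset.mul_sum]
    refine Finset.sum_congr rfl fun G _ => ?_
    dsimp only
    rw [← Finset.sum_mul, ← mul_assoc, comps_eq, add_comm z 1, ← Finset.sum_pow_mul_eq_add_pow,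
      Finset.mul_sum]
    congr 1
    refine Finset.sum_congr rfl fun T _ => ?_
    rw [pow_succ]; ring
  rw [key]
  symm
  refine Finset.sum_bij (fun x _ => ins r x.1 x.2) ?_ ?_ ?_ ?_
  · intro x _
    simp [mem_roots, ins, insP_self]
  · rintro ⟨G, T⟩ h1 ⟨G', T'⟩ h2 h
    simp only [Finset.mem_sigma, Finset.mem_univ, true_and, Finset.mem_powerset] at h1 h2
    obtain ⟨rfl, rfl⟩ := ins_inj r h1 h2 h
    rfl
  · intro F hF
    simp only [Finset.mem_filter, Finset.mem_univ, true_and, mem_roots] at hF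
    obtain ⟨G, T, hT, h⟩ := exists_ins r F hF
    exact ⟨⟨G, T⟩, by simpa using hT, h⟩
  · rintro ⟨G, T⟩ h1
    simp only [Finset.mem_sigma, Finset.mem_univ, true_and, Finset.mem_powerset] at h1
    have hr : ((ins r G T).h r : ℝ) ≠ 0 := by
      have := (ins r G T).h_pos r
      positivity
    have hh : ∀ w, (ins r G T).h (r.succAbove w) = G.h w :=
      fun w => DelRel.h_eq (insP_rel r G T) w
    rw [Fin.prod_univ_succAbove _ r, comps_ins r G T h1]
    simp only [hh]
    field_simp

theorem S_succ (n : ℕ) (z : ℝ) : S (n+1) z = z * S n (z+1) := by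
  have h : ((n:ℝ)+1) * S (n+1) z = ((n:ℝ)+1) * (z * S n (z+1)) := by
    have h1 : ∑ r : Fin (n+1), z * S n (z+1) = ((n:ℝ)+1) * (z * S n (z+1)) := by simp
    rw [← h1, ← Finset.sum_congr rfl (fun r _ => sum_root r z)]
    simp_rw [Finset.sum_filter]
    rw [Finset.sum_comm, S, Finset.mul_sum]
    refine Finset.sum_congr rfl fun F _ => ?_
    rw [← Finset.sum_filter, ← Finset.mul_sum, mul_comm]
    congr 1
    have := F.sum_h_roots
    simp only [Finset.filter_mem_eq_inter, Finset.univ_inter]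
    exact_mod_cast this.symm
  exact mul_left_cancel₀ (by positivity) h

theorem S_eq (n : ℕ) : ∀ z : ℝ, S n z = ∏ i ∈ Finset.range n, (z + i) := by
  induction n with
  | zero =>
    intro z
    let F0 : RootedForest (Fin 0) := ⟨fun v => v.elim0, fun v => v.elim0⟩
    rw [S, Finset.sum_eq_single F0]
    · simp [comps_eq, roots]
    · intro b _ hb
      exact absurd (ext_parent fun v => v.elim0) hb
    · simp
  | succ n ih =>
    intro z
    rw [S_succ, ih, Finset.prod_range_succ']
    simp only [Nat.cast_zero, add_zero]
    rw [mul_comm]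
    congr 1
    refine Finset.prod_congr rfl fun i _ => ?_
    push_cast; ring

end RootedForest

/-- For every `n ≥ 1` and every real `z`,
`∑_{F ∈ R_n} z^{c(F)} ∏_{v} 1/h(v) = z(z+1)(z+2)⋯(z+n-1)`,
where `c(F)` is the number of connected components of `F`. -/
theorem stmt19 (n : ℕ) (hn : 1 ≤ n) (z : ℝ) :
    ∑ F : RootedForest (Fin n), z ^ F.comps * ∏ v : Fin n, (1 : ℝ) / (F.h v : ℝ)
      = ∏ i ∈ Finset.range n, (z + i) :=
  RootedForest.S_eq n z
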